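/- (Energy decay without forcing.) Let d ≥ 1, ν > 0, α > 0, β ≥ 0, and let (w, λ) be a classical compactly supported solution of the hybrid model with f = 0: w : ℝ × ℝᵈ → ℝᵈ and λ : ℝ × ℝᵈ → ℝ are twice continuously differentiable jointly in (t, x), there is a compact set K ⊂ ℝᵈ with supp w(t,·) ⊆ K and supp λ(t,·) ⊆ K for every t, and for all (t, x): ∂_t w + (w·∇)w + (1/2)(div w)·w − νΔw + ∇λ = 0 and ∂_t λ + 2β·div(∂_t w) + α²·div w = 0. Then the model energy E(t) := (1/2)∫_{ℝᵈ}|w(t,x)|² dx + (α⁻²/2)∫_{ℝᵈ}(λ(t,x) + 2β·div w(t,x))² dx is a nonincreasing function of t. -/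

import Mathlib

open MeasureTheory

/-- Divergence of a vector field on `ℝᵈ`. -/
noncomputable def vdiv {d : ℕ} (u : (Fin d → ℝ) → (Fin d → ℝ))
    (x : Fin d → ℝ) : ℝ := ∑ i, fderiv ℝ u x (Pi.single i 1) i

/-- `i`-th component of the (componentwise) Laplacian of a vector field. -/
noncomputable def vlap {d : ℕ} (u : (Fin d → ℝ) → (Fin d → ℝ))
    (x : Fin d → ℝ) (i : Fin d) : ℝ :=
  ∑ j, fderiv ℝ (fun y => fderiv ℝ u y (Pi.single j 1) i) x (Pi.single j 1)

/-- The integral of a directional derivative of a compactly supported `C¹` function vanishes. -/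
theorem integral_fderiv_apply_eq_zero {E : Type*} [NormedAddCommGroup E] [NormedSpace ℝ E]
    [FiniteDimensional ℝ E] [MeasurableSpace E] [BorelSpace E] {μ : Measure E}
    [μ.IsAddHaarMeasure] {f : E → ℝ} (hf : ContDiff ℝ 1 f) (hc : HasCompactSupport f) (v : E) :
    ∫ x, fderiv ℝ f x v ∂μ = 0 := by
  have hi : Integrable (fun x => fderiv ℝ f x v) μ :=
    ((hf.continuous_fderiv one_ne_zero).clm_apply continuous_const).integrable_of_hasCompactSupport
      (hc.fderiv_apply ℝ v)
  have h := integral_mul_fderiv_eq_neg_fderiv_mul_of_integrable (μ := μ) (f := fun _ => (1 : ℝ))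
    (g := f) (v := v) (by simp) (by simpa using hi)
    (by simpa using hf.continuous.integrable_of_hasCompactSupport hc)
    (fun _ _ => differentiableAt_const _) (fun x _ => hf.differentiable one_ne_zero x)
  simpa using h

/-- A time slice of a jointly differentiable function is differentiable in time. -/
theorem hasDerivAt_prodMk_slice {E G : Type*} [NormedAddCommGroup E] [NormedSpace ℝ E]
    [NormedAddCommGroup G] [NormedSpace ℝ G] {F : ℝ × E → G} (hF : Differentiable ℝ F)
    (t : ℝ) (x : E) : HasDerivAt (fun s => F (s, x)) (fderiv ℝ F (t, x) (1, 0)) t :=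
  (hF (t, x)).hasFDerivAt.comp_hasDerivAt t ((hasDerivAt_id t).prodMk (hasDerivAt_const t x))

/-- The derivative of a space slice of a jointly differentiable function. -/
theorem fderiv_prodMk_slice_apply {E G : Type*} [NormedAddCommGroup E] [NormedSpace ℝ E]
    [NormedAddCommGroup G] [NormedSpace ℝ G] {F : ℝ × E → G} (hF : Differentiable ℝ F)
    (t : ℝ) (x v : E) : fderiv ℝ (fun y => F (t, y)) x v = fderiv ℝ F (t, x) (0, v) := by
  have h : HasFDerivAt (fun y => F (t, y)) _ x :=
    (hF (t, x)).hasFDerivAt.comp x (hasFDerivAt_prodMk_right t x)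
  simp [h.fderiv]

/-- Time and space derivatives of a jointly `C²` function commute. -/
theorem hasDerivAt_fderiv_slice_apply {E : Type*} [NormedAddCommGroup E] [NormedSpace ℝ E]
    {F : ℝ × E → ℝ} (hF : ContDiff ℝ 2 F) (t : ℝ) (x v : E) :
    HasDerivAt (fun s => fderiv ℝ (fun y => F (s, y)) x v)
      (fderiv ℝ (fun y => deriv (fun s => F (s, y)) t) x v) t := by
  have hd : Differentiable ℝ F := hF.differentiable two_ne_zero
  have hd' : Differentiable ℝ (fderiv ℝ F) :=
    (hF.fderiv_right (m := 1) (by norm_num)).differentiable one_ne_zero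
  have hsymm : IsSymmSndFDerivAt ℝ F (t, x) :=
    hF.contDiffAt.isSymmSndFDerivAt (by simp)
  have hspace : (fun y => deriv (fun s => F (s, y)) t) = fun y => fderiv ℝ F (t, y) (1, 0) :=
    funext fun y => (hasDerivAt_prodMk_slice hd t y).deriv
  simp only [fderiv_prodMk_slice_apply hd, hspace]
  have h := (hasDerivAt_prodMk_slice hd' t x).clm_apply (hasDerivAt_const t ((0 : ℝ), v))
  have hslice : fderiv ℝ (fun y => fderiv ℝ F (t, y) (1, 0)) x v
      = fderiv ℝ (fderiv ℝ F) (t, x) (0, v) (1, 0) := by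
    rw [fderiv_prodMk_slice_apply (F := fun q => fderiv ℝ F q (1, 0))
      (hd'.clm_apply (differentiable_const _)),
      fderiv_clm_apply (hd' _) (differentiableAt_const _)]
    simp
  rw [hslice, hsymm.eq]
  simpa using h

/-- Differentiation under the integral sign for a `C¹` function supported in a fixed compact set. -/
theorem hasDerivAt_integral_of_isCompact {E : Type*} [NormedAddCommGroup E] [NormedSpace ℝ E]
    [MeasurableSpace E] [BorelSpace E] [SecondCountableTopology E] {μ : Measure E}
    [IsFiniteMeasureOnCompacts μ] {F : ℝ × E → ℝ} (hF : ContDiff ℝ 1 F) {K : Set E}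
    (hK : IsCompact K) (hFK : ∀ t, ∀ x ∉ K, F (t, x) = 0) (t : ℝ) :
    Integrable (fun x => deriv (fun s => F (s, x)) t) μ ∧
      HasDerivAt (fun s => ∫ x, F (s, x) ∂μ) (∫ x, deriv (fun s => F (s, x)) t ∂μ) t := by
  have hderiv (s x) := hasDerivAt_prodMk_slice (hF.differentiable one_ne_zero) s x
  have hcont : Continuous fun q : ℝ × E => deriv (fun s => F (s, q.2)) q.1 := by
    simp only [(hderiv _ _).deriv]
    exact (hF.continuous_fderiv one_ne_zero).clm_apply continuous_const
  obtain ⟨C, hC⟩ := ((isCompact_Icc (a := t - 1) (b := t + 1)).prod hK).exists_bound_of_continuousOn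
    hcont.continuousOn
  refine hasDerivAt_integral_of_dominated_loc_of_deriv_le (F := fun s x => F (s, x))
    (F' := fun s x => deriv (fun r => F (r, x)) s) (s := Set.Icc (t - 1) (t + 1))
    (bound := K.indicator fun _ => C) (Icc_mem_nhds (by linarith) (by linarith))
    (.of_forall fun s => (hF.continuous.comp (by fun_prop)).aestronglyMeasurable)
    ((hF.continuous.comp (by fun_prop)).integrable_of_hasCompactSupport
      (HasCompactSupport.intro hK fun x hx => hFK t x hx))
    (hcont.comp (by fun_prop : Continuous fun x : E => (t, x))).aestronglyMeasurable
    (.of_forall fun x s hs => ?_) ?_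
    (.of_forall fun x s _ => (hderiv s x).differentiableAt.hasDerivAt)
  · by_cases hx : x ∈ K
    · simpa [hx] using hC (s, x) ⟨hs, hx⟩
    · simp [hx, hFK]
  · exact (integrable_indicator_iff hK.measurableSet).2 (integrableOn_const hK.measure_lt_top.ne)

/-- The `j`-th component of the spatial energy flux of a velocity `u` with pressure `p`. -/
noncomputable def energyFlux {d : ℕ} (ν : ℝ) (u : (Fin d → ℝ) → (Fin d → ℝ))
    (p : (Fin d → ℝ) → ℝ) (j : Fin d) (y : Fin d → ℝ) : ℝ :=
  -(1 / 2) * ((∑ i, u y i ^ 2) * u y j)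
    + ν * (∑ i, u y i * fderiv ℝ u y (Pi.single j 1) i) - p y * u y j

theorem contDiff_fderiv_apply_apply {d : ℕ} {u : (Fin d → ℝ) → (Fin d → ℝ)}
    (hu : ContDiff ℝ 2 u) (v : Fin d → ℝ) (i : Fin d) :
    ContDiff ℝ 1 fun y => fderiv ℝ u y v i :=
  contDiff_pi.1 ((hu.fderiv_right (m := 1) (by norm_num)).clm_apply contDiff_const) i

theorem contDiff_energyFlux {d : ℕ} (ν : ℝ) {u : (Fin d → ℝ) → (Fin d → ℝ)}
    {p : (Fin d → ℝ) → ℝ} (hu : ContDiff ℝ 2 u) (hp : ContDiff ℝ 1 p) (j : Fin d) :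
    ContDiff ℝ 1 (energyFlux ν u p j) := by
  have hui (i) : ContDiff ℝ 1 fun y => u y i := contDiff_pi.1 (hu.of_le (by norm_num)) i
  have hdu (i) := contDiff_fderiv_apply_apply hu (Pi.single j 1) i
  exact ((contDiff_const.mul ((ContDiff.sum fun i _ => (hui i).pow 2).mul (hui j))).add
    (contDiff_const.mul (ContDiff.sum fun i _ => (hui i).mul (hdu i)))).sub (hp.mul (hui j))

theorem clm_apply_eq_sum_single {d : ℕ} (L : (Fin d → ℝ) →L[ℝ] (Fin d → ℝ)) (v : Fin d → ℝ)
    (i : Fin d) : L v i = ∑ j, v j * L (Pi.single j 1) i := by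
  conv_lhs => rw [pi_eq_sum_univ' v]
  simp [Finset.sum_apply]

/-- The divergence of the energy flux. -/
theorem sum_fderiv_energyFlux {d : ℕ} (ν : ℝ) {u : (Fin d → ℝ) → (Fin d → ℝ)}
    {p : (Fin d → ℝ) → ℝ} (hu : ContDiff ℝ 2 u) (hp : ContDiff ℝ 1 p) (x : Fin d → ℝ) :
    ∑ j, fderiv ℝ (energyFlux ν u p j) x (Pi.single j 1)
      = ∑ i, u x i * (-(fderiv ℝ u x (u x) i) - (1 / 2) * vdiv u x * u x i
            + ν * vlap u x i - fderiv ℝ p x (Pi.single i 1))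
        + ν * ∑ j, ∑ i, fderiv ℝ u x (Pi.single j 1) i ^ 2 - p x * vdiv u x := by
  have hui (i) : HasFDerivAt (fun y => u y i)
      ((ContinuousLinearMap.proj i).comp (fderiv ℝ u x)) x :=
    (hasFDerivAt_pi'.1 (hu.differentiable two_ne_zero x).hasFDerivAt) i
  have hdu (j i) := ((contDiff_fderiv_apply_apply hu (Pi.single j 1) i).differentiable
    one_ne_zero x).hasFDerivAt
  have hpx := (hp.differentiable one_ne_zero x).hasFDerivAt
  have hflux (j : Fin d) : fderiv ℝ (energyFlux ν u p j) x (Pi.single j 1)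
      = -(1 / 2) * ((∑ i, u x i ^ 2) * fderiv ℝ u x (Pi.single j 1) j
          + u x j * ∑ i, 2 * u x i * fderiv ℝ u x (Pi.single j 1) i)
        + ν * (∑ i, (u x i * fderiv ℝ (fun y => fderiv ℝ u y (Pi.single j 1) i) x (Pi.single j 1)
          + fderiv ℝ u x (Pi.single j 1) i ^ 2))
        - (p x * fderiv ℝ u x (Pi.single j 1) j + u x j * fderiv ℝ p x (Pi.single j 1)) := by
    have h := ((((HasFDerivAt.fun_sum fun i (_ : i ∈ Finset.univ) => (hui i).pow 2).mul
      (hui j)).const_mul (-(1 / 2))).add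
      ((HasFDerivAt.fun_sum fun i (_ : i ∈ Finset.univ) =>
        (hui i).mul (hdu j i)).const_mul ν)).sub (hpx.mul (hui j))
    have h' : HasFDerivAt (energyFlux ν u p j) _ x := h
    rw [h'.fderiv]
    simp [pow_two]
    ring
  simp only [hflux, clm_apply_eq_sum_single (fderiv ℝ u x) (u x), vdiv, vlap]
  have hconv : ∑ j, u x j * ∑ i, 2 * u x i * fderiv ℝ u x (Pi.single j 1) i
      = 2 * ∑ i, u x i * ∑ j, u x j * fderiv ℝ u x (Pi.single j 1) i := by
    simp only [Finset.mul_sum]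
    rw [Finset.sum_comm]
    exact Finset.sum_congr rfl fun i _ => Finset.sum_congr rfl fun j _ => by ring
  have hvisc : ∑ j, ∑ i, u x i *
        fderiv ℝ (fun y => fderiv ℝ u y (Pi.single j 1) i) x (Pi.single j 1)
      = ∑ i, u x i * ∑ j,
        fderiv ℝ (fun y => fderiv ℝ u y (Pi.single j 1) i) x (Pi.single j 1) := by
    simp only [Finset.mul_sum]
    exact Finset.sum_comm
  have hrhs (c : ℝ) (a b q : Fin d → ℝ) : ∑ i, u x i * (-a i - (1 / 2) * c * u x i + ν * b i - q i)
      = -(∑ i, u x i * a i) - (1 / 2) * ((∑ i, u x i ^ 2) * c) + ν * (∑ i, u x i * b i)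
        - ∑ i, u x i * q i := by
    simp only [Finset.mul_sum, Finset.sum_mul, ← Finset.sum_neg_distrib, ← Finset.sum_add_distrib,
      ← Finset.sum_sub_distrib]
    exact Finset.sum_congr rfl fun i _ => by ring
  rw [hrhs]
  simp only [Finset.sum_add_distrib, Finset.sum_sub_distrib, ← Finset.mul_sum, hvisc]
  rw [hconv]
  ring

/-- **Energy decay of the Ramshaw–Mesina hybrid model without forcing.**
For a classical compactly supported solution `(w, λ)` of the hybrid model with
`f = 0`, the model energy
`E(t) = (1/2)∫|w(t)|² + (α⁻²/2)∫(λ(t) + 2β div w(t))²`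
is a nonincreasing function of `t`. -/
theorem hybrid_model_energy_decay
    (d : ℕ) (hd : 1 ≤ d) (ν α β : ℝ) (hν : 0 < ν) (hα : 0 < α) (hβ : 0 ≤ β)
    (w : ℝ → (Fin d → ℝ) → (Fin d → ℝ)) (lam : ℝ → (Fin d → ℝ) → ℝ)
    (hw : ContDiff ℝ 2 (fun q : ℝ × (Fin d → ℝ) => w q.1 q.2))
    (hlam : ContDiff ℝ 2 (fun q : ℝ × (Fin d → ℝ) => lam q.1 q.2))
    (K : Set (Fin d → ℝ)) (hK : IsCompact K)
    (hsuppw : ∀ t : ℝ, Function.support (w t) ⊆ K)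
    (hsupplam : ∀ t : ℝ, Function.support (lam t) ⊆ K)
    -- momentum equation with zero body force, componentwise
    (hmom : ∀ (t : ℝ) (x : Fin d → ℝ) (i : Fin d),
      deriv (fun s => w s x i) t + fderiv ℝ (w t) x (w t x) i
        + (1 / 2) * vdiv (w t) x * w t x i - ν * vlap (w t) x i
        + fderiv ℝ (lam t) x (Pi.single i 1) = 0)
    -- hybrid continuity relaxation
    (hcont : ∀ (t : ℝ) (x : Fin d → ℝ),
      deriv (fun s => lam s x) t
        + 2 * β * vdiv (fun x' => fun i => deriv (fun s => w s x' i) t) x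
        + α ^ 2 * vdiv (w t) x = 0) :
    Antitone (fun t : ℝ =>
      (1 / 2) * (∫ x : Fin d → ℝ, ∑ i, (w t x i) ^ 2)
        + ((α ^ 2)⁻¹ / 2) *
            (∫ x : Fin d → ℝ, (lam t x + 2 * β * vdiv (w t) x) ^ 2)) := by
  have hwt (t) : ContDiff ℝ 2 (w t) := hw.comp (contDiff_const.prodMk contDiff_id)
  have hlt (t) : ContDiff ℝ 1 (lam t) :=
    (hlam.of_le (by norm_num)).comp (contDiff_const.prodMk contDiff_id)
  have hwi (i) : ContDiff ℝ 2 fun q : ℝ × (Fin d → ℝ) => w q.1 q.2 i := contDiff_pi.1 hw i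
  have hw0 (t x) (hx : x ∉ K) : w t x = 0 := Function.notMem_support.1 fun h => hx (hsuppw t h)
  have hl0 (t x) (hx : x ∉ K) : lam t x = 0 :=
    Function.notMem_support.1 fun h => hx (hsupplam t h)
  have hdw0 (t x) (hx : x ∉ K) : fderiv ℝ (w t) x = 0 :=
    fderiv_of_notMem_tsupport ℝ fun h => hx (closure_minimal (hsuppw t) hK.isClosed h)
  have hcomp {u : (Fin d → ℝ) → (Fin d → ℝ)} {x} (hu : DifferentiableAt ℝ u x) (v i) :
      fderiv ℝ u x v i = fderiv ℝ (fun y => u y i) x v := by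
    rw [(hasFDerivAt_pi'.1 hu.hasFDerivAt i).fderiv]; rfl
  have hdiv (t x) : vdiv (w t) x = ∑ i, fderiv ℝ (fun y => w t y i) x (Pi.single i 1) :=
    Finset.sum_congr rfl fun i _ => hcomp ((hwt t).differentiable two_ne_zero x) _ i
  have hdivC : ContDiff ℝ 1 fun q : ℝ × (Fin d → ℝ) => vdiv (w q.1) q.2 := by
    simp only [hdiv]
    refine ContDiff.sum fun i _ => ?_
    simp only [fderiv_prodMk_slice_apply ((hwi i).differentiable two_ne_zero)]
    exact ((hwi i).fderiv_right (by norm_num)).clm_apply contDiff_const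
  have hdivt (t x) : HasDerivAt (fun s => vdiv (w s) x)
      (vdiv (fun x' => fun i => deriv (fun s => w s x' i) t) x) t := by
    have hdt : DifferentiableAt ℝ (fun x' => fun i => deriv (fun s => w s x' i) t) x := by
      refine differentiableAt_pi.2 fun i => ?_
      have h (y) := (hasDerivAt_prodMk_slice ((hwi i).differentiable two_ne_zero) t y).deriv
      simp only [h]
      exact ((((hwi i).fderiv_right (m := 1) (by norm_num)).clm_apply contDiff_const).comp
        (contDiff_const.prodMk contDiff_id)).differentiable one_ne_zero x
    simp only [hdiv]
    simp only [vdiv, hcomp hdt]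
    exact HasDerivAt.fun_sum fun i _ => hasDerivAt_fderiv_slice_apply (hwi i) t x _
  have hwd (t x i) : HasDerivAt (fun s => w s x i) (deriv (fun s => w s x i) t) t :=
    (hasDerivAt_prodMk_slice ((hwi i).differentiable two_ne_zero) t x).differentiableAt.hasDerivAt
  have hld (t x) : HasDerivAt (fun s => lam s x) (deriv (fun s => lam s x) t) t :=
    (hasDerivAt_prodMk_slice
      (hlam.differentiable two_ne_zero) t x).differentiableAt.hasDerivAt
  let e : ℝ × (Fin d → ℝ) → ℝ := fun q => (1 / 2) * (∑ i, (w q.1 q.2 i) ^ 2)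
    + ((α ^ 2)⁻¹ / 2) * (lam q.1 q.2 + 2 * β * vdiv (w q.1) q.2) ^ 2
  have heC : ContDiff ℝ 1 e :=
    (contDiff_const.mul (ContDiff.sum fun i _ => ((hwi i).of_le (by norm_num)).pow 2)).add
      (contDiff_const.mul (((hlam.of_le (by norm_num)).add (contDiff_const.mul hdivC)).pow 2))
  have he0 (t x) (hx : x ∉ K) : e (t, x) = 0 := by
    simp [e, vdiv, hw0 t x hx, hl0 t x hx, hdw0 t x hx]
  have hE (t) : (1 / 2) * (∫ x : Fin d → ℝ, ∑ i, (w t x i) ^ 2) + ((α ^ 2)⁻¹ / 2) *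
      (∫ x : Fin d → ℝ, (lam t x + 2 * β * vdiv (w t) x) ^ 2) = ∫ x, e (t, x) := by
    have hslice : Continuous fun x : Fin d → ℝ => (t, x) := by fun_prop
    rw [integral_add, integral_const_mul, integral_const_mul]
    · refine Integrable.const_mul (Continuous.integrable_of_hasCompactSupport ?_
        (HasCompactSupport.intro hK fun x hx => by simp [hw0 t x hx])) _
      exact continuous_finsetSum _ fun i _ => ((hwi i).continuous.comp hslice).pow 2
    · refine Integrable.const_mul (Continuous.integrable_of_hasCompactSupport ?_
        (HasCompactSupport.intro hK fun x hx => by simp [vdiv, hl0 t x hx, hdw0 t x hx])) _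
      exact ((hlam.continuous.comp hslice).add
        (continuous_const.mul (hdivC.continuous.comp hslice))).pow 2
  simp only [hE]
  refine antitone_of_hasDerivAt_nonpos
    (fun t => (hasDerivAt_integral_of_isCompact heC hK he0 t).2) fun t => ?_
  have hfluxC (j) := contDiff_energyFlux ν (hwt t) (hlt t) j
  have hflux0 (j) : HasCompactSupport (energyFlux ν (w t) (lam t) j) :=
    HasCompactSupport.intro hK fun x hx => by simp [energyFlux, hw0 t x hx]
  have hfluxI (j : Fin d) : Integrable fun x =>
      fderiv ℝ (energyFlux ν (w t) (lam t) j) x (Pi.single j 1) :=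
    (((hfluxC j).continuous_fderiv one_ne_zero).clm_apply
      continuous_const).integrable_of_hasCompactSupport ((hflux0 j).fderiv_apply ℝ _)
  calc ∫ x, deriv (fun s => e (s, x)) t
      ≤ ∫ x, ∑ j, fderiv ℝ (energyFlux ν (w t) (lam t) j) x (Pi.single j 1) := by
        refine integral_mono (hasDerivAt_integral_of_isCompact heC hK he0 t).1
          (integrable_finsetSum _ fun j _ => hfluxI j) fun x => ?_
        have hed : deriv (fun s => e (s, x)) t = ∑ i, w t x i * deriv (fun s => w s x i) t
            - (lam t x + 2 * β * vdiv (w t) x) * vdiv (w t) x := by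
          have h := ((HasDerivAt.fun_sum fun i (_ : i ∈ Finset.univ) =>
            (hwd t x i).pow 2).const_mul (1 / 2)).add
            ((((hld t x).add ((hdivt t x).const_mul (2 * β))).pow 2).const_mul ((α ^ 2)⁻¹ / 2))
          have h' : HasDerivAt (fun s => e (s, x)) _ t := h
          have hP : deriv (fun s => lam s x) t
              + 2 * β * vdiv (fun x' => fun i => deriv (fun s => w s x' i) t) x
              = -(α ^ 2 * vdiv (w t) x) := by linarith [hcont t x]
          rw [h'.deriv, hP, Finset.mul_sum, sub_eq_add_neg]
          congr 1
          · exact Finset.sum_congr rfl fun i _ => by simp; ring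
          · simp; field_simp
        have hmom' (i) : deriv (fun s => w s x i) t = -(fderiv ℝ (w t) x (w t x) i)
            - (1 / 2) * vdiv (w t) x * w t x i + ν * vlap (w t) x i
            - fderiv ℝ (lam t) x (Pi.single i 1) := by linarith [hmom t x i]
        simp only [hed, hmom', sum_fderiv_energyFlux ν (hwt t) (hlt t) x]
        have h1 : 0 ≤ ν * ∑ j, ∑ i, fderiv ℝ (w t) x (Pi.single j 1) i ^ 2 := by positivity
        have h2 : 0 ≤ β * vdiv (w t) x ^ 2 := by positivity
        linarith
    _ = 0 := by
        rw [integral_finsetSum _ fun j _ => hfluxI j]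
        exact Finset.sum_eq_zero fun j _ =>
          integral_fderiv_apply_eq_zero (hfluxC j) (hflux0 j) _
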